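/- Let (R, 𝔪) be a two-dimensional regular local ring with infinite residue field, let I be an integrally closed 𝔪-primary ideal with ord(I) = n ≥ r ≥ 2, and let M = M_r(I) ⊆ F = R^r. Then M is integrally closed: every element of F that is integral over M lies in M. -/

import Mathlib

open IsLocalRing

section Defs

variable {R : Type*} [CommRing R]

/-- `R` is a two-dimensional regular local ring: Noetherian local of Krull dimension 2
whose maximal ideal is generated by two elements. -/
def IsTwoDimRegularLocal (R : Type*) [CommRing R] [IsLocalRing R] : Prop :=
  IsNoetherianRing R ∧ ringKrullDim R = 2 ∧
    ∃ x y : R, maximalIdeal R = Ideal.span {x, y}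

/-- `z` lies in the integral closure of the ideal `I`, i.e. it satisfies an equation
`z ^ n + c 1 * z ^ (n-1) + ⋯ + c n = 0` with `c i ∈ I ^ i`. -/
def MemIntClosure (I : Ideal R) (z : R) : Prop :=
  ∃ n : ℕ, 0 < n ∧ ∃ c : ℕ → R, (∀ i ∈ Finset.Icc 1 n, c i ∈ I ^ i) ∧
    z ^ n + ∑ i ∈ Finset.Icc 1 n, c i * z ^ (n - i) = 0

/-- The ideal `I` is integrally closed. -/
def IdealIntClosed (I : Ideal R) : Prop := ∀ z, MemIntClosure I z → z ∈ I

/-- `I` is `𝔪`-primary. -/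
def IsMPrimary [IsLocalRing R] (I : Ideal R) : Prop := I.radical = maximalIdeal R

/-- `ord I = n` : `n` is the largest power of the maximal ideal containing `I`. -/
def ordEQ [IsLocalRing R] (I : Ideal R) (n : ℕ) : Prop :=
  I ≤ maximalIdeal R ^ n ∧ ¬ I ≤ maximalIdeal R ^ (n + 1)

/-- Determinant of the square matrix with columns `w 0, …, w (r-1)`. -/
def colDet {r : ℕ} (w : Fin r → Fin r → R) : R :=
  Matrix.det (Matrix.of fun i j => w j i)

/-- The ideal of maximal minors `I(M)` of a submodule `M ⊆ R^r`:  it is generated by all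
determinants of `r × r` matrices whose columns lie in `M`. -/
def maxMinors {r : ℕ} (M : Submodule R (Fin r → R)) : Ideal R :=
  Ideal.span { d | ∃ w : Fin r → Fin r → R, (∀ j, w j ∈ M) ∧ d = colDet w }

/-- The ideal `I_k(M)` of `k × k` minors of a matrix whose columns generate `M ⊆ R^r`. -/
def minorsIdeal (k : ℕ) {r : ℕ} (M : Submodule R (Fin r → R)) : Ideal R :=
  Ideal.span { d | ∃ (w : Fin k → Fin r → R) (ρ : Fin k → Fin r),
    Function.Injective ρ ∧ (∀ j, w j ∈ M) ∧
    d = Matrix.det (Matrix.of fun i j : Fin k => w j (ρ i)) }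

/-- `v ∈ R^r` is integral over the submodule `M ⊆ R^r` : the determinant of every square
matrix with one column `v` and the remaining columns in `M` is integral over `I(M)`. -/
def IntegralOverMod {r : ℕ} (M : Submodule R (Fin r → R)) (v : Fin r → R) : Prop :=
  ∀ (w : Fin r → Fin r → R) (j₀ : Fin r), w j₀ = v → (∀ j, j ≠ j₀ → w j ∈ M) →
    MemIntClosure (maxMinors M) (colDet w)

/-- The submodule `M ⊆ R^r` is integrally closed. -/
def ModIntClosed {r : ℕ} (M : Submodule R (Fin r → R)) : Prop :=
  ∀ v, IntegralOverMod M v → v ∈ M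

/-- The length of an `R`-module, as the Krull dimension of its submodule lattice. -/
noncomputable def modLength (R : Type*) (M : Type*) [CommRing R] [AddCommGroup M]
    [Module R M] : WithBot ℕ∞ :=
  Order.krullDim (Submodule R M)

/-- `M ⊆ R^r` has finite colength; equivalently, `M` is a finitely generated torsion-free
module of rank `r` with double dual `M** = R^r`. -/
def FinColength {r : ℕ} (M : Submodule R (Fin r → R)) : Prop :=
  IsFiniteLength R ((Fin r → R) ⧸ M)

/-- `M` has a nonzero free direct summand. -/
def HasFreeSummand {r : ℕ} (M : Submodule R (Fin r → R)) : Prop :=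
  ∃ N P : Submodule R (Fin r → R), N ⊔ P = M ∧ N ⊓ P = ⊥ ∧ N ≠ ⊥ ∧ Module.Free R ↥N

/-- `M` is a direct sum of two nonzero submodules. -/
def DecomposableSub {r : ℕ} (M : Submodule R (Fin r → R)) : Prop :=
  ∃ N P : Submodule R (Fin r → R), N ⊔ P = M ∧ N ⊓ P = ⊥ ∧ N ≠ ⊥ ∧ P ≠ ⊥

/-- `M` is nonzero and not a direct sum of two nonzero submodules. -/
def IndecomposableSub {r : ℕ} (M : Submodule R (Fin r → R)) : Prop :=
  M ≠ ⊥ ∧ ¬ DecomposableSub M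

/-- `a` is a minimal generating set of the ideal `I`. -/
def MinGens {m : ℕ} (I : Ideal R) (a : Fin m → R) : Prop :=
  Ideal.span (Set.range a) = I ∧ ∀ j : Fin m, Ideal.span (a '' {j}ᶜ) ≠ I

/-- `a = c 0 * x^(r-1) + c 1 * x^(r-2) * y + ⋯ + c (r-1) * y^(r-1)`. -/
def Expresses (r : ℕ) (x y : R) (c : Fin r → R) (a : R) : Prop :=
  a = ∑ i : Fin r, c i * x ^ (r - 1 - (i : ℕ)) * y ^ (i : ℕ)

/-- The `k`-th Koszul relation column between `x^(r-1), …, y^(r-1)`: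
`y` in position `k` and `-x` in position `k+1`. -/
def stdRelCol (r : ℕ) (x y : R) (k : ℕ) : Fin r → R :=
  fun i => if (i : ℕ) = k then y else if (i : ℕ) = k + 1 then -x else 0

/-- The module generated by the coefficient columns `C j` together with the `r - 1`
Koszul relation columns between `x^(r-1), …, y^(r-1)`. -/
def MrSpan (r : ℕ) (x y : R) {m : ℕ} (C : Fin m → Fin r → R) :
    Submodule R (Fin r → R) :=
  Submodule.span R (Set.range C ∪ { v | ∃ k, k < r - 1 ∧ v = stdRelCol r x y k })

/-- The data `(x, y, a, C)` presents the module `M_r(I)` : `𝔪 = (x,y)`, `a` is a minimal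
generating set of `I` and column `C j` expresses `a j` in terms of `x^(r-1), …, y^(r-1)`. -/
def IsMrPresentation [IsLocalRing R] (r : ℕ) (I : Ideal R) {m : ℕ} (x y : R)
    (a : Fin m → R) (C : Fin m → Fin r → R) : Prop :=
  maximalIdeal R = Ideal.span {x, y} ∧ MinGens I a ∧ ∀ j, Expresses r x y (C j) (a j)

/-- `N` is a reduction of `M` : `N ≤ M` and every element of `M` is integral over `N`. -/
def IsReductionMod {r : ℕ} (N M : Submodule R (Fin r → R)) : Prop :=
  N ≤ M ∧ ∀ v ∈ M, IntegralOverMod N v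

/-- `N` is a minimal reduction of `M`. -/
def IsMinimalReductionMod {r : ℕ} (N M : Submodule R (Fin r → R)) : Prop :=
  IsReductionMod N M ∧ ∀ N' ≤ N, IsReductionMod N' M → N' = N

/-- The `j`-th signed maximal minor of an `r × (r+1)` matrix. -/
def signedMinor {r : ℕ} (A : Matrix (Fin r) (Fin (r + 1)) R) (j : Fin (r + 1)) : R :=
  (-1 : R) ^ (j : ℕ) * (A.submatrix id j.succAbove).det

/-- `M ⊆ R^r` is extremal: integrally closed, without free direct summands, with
`λ(R/I(M)) = λ(R^r/M) + r(r-1)/2`. -/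
def IsExtremal {r : ℕ} (M : Submodule R (Fin r → R)) : Prop :=
  FinColength M ∧ ModIntClosed M ∧ ¬ HasFreeSummand M ∧
    modLength R (R ⧸ maxMinors M) =
      modLength R ((Fin r → R) ⧸ M) + ((r * (r - 1) / 2 : ℕ) : WithBot ℕ∞)

/-- `a ∈ J`, `b ∈ K` is a joint reduction of the pair `(J, K)`. -/
def IsJointReduction (J K : Ideal R) (a b : R) : Prop :=
  a ∈ J ∧ b ∈ K ∧ ∃ n : ℕ,
    (Ideal.span {a} * K + Ideal.span {b} * J) * (J * K) ^ n = (J * K) ^ (n + 1)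

/-- `S` is the matrix `Sym^k(Q)` for `Q = [[a, c], [b, d]]` : with `X = aU + bV`,
`Y = cU + dV`, the `j`-th column of `S` records the coefficients of
`X^(k-j) Y^j` in terms of `U^k, U^(k-1)V, …, V^k`. -/
def IsSymOf (k : ℕ) (a b c d : R) (S : Matrix (Fin (k + 1)) (Fin (k + 1)) R) : Prop :=
  ∀ j : Fin (k + 1),
    ((MvPolynomial.C a * MvPolynomial.X 0 + MvPolynomial.C b * MvPolynomial.X 1) ^ (k - (j : ℕ)) *
        (MvPolynomial.C c * MvPolynomial.X 0 + MvPolynomial.C d * MvPolynomial.X 1) ^ (j : ℕ)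
      : MvPolynomial (Fin 2) R)
    = ∑ i : Fin (k + 1), MvPolynomial.C (S i j) *
        MvPolynomial.X 0 ^ (k - (i : ℕ)) * MvPolynomial.X 1 ^ (i : ℕ)

/-- The `r × s` bidiagonal matrix with `y` on the diagonal and `-x` directly below it. -/
def bidiag (r s : ℕ) (x y : R) : Matrix (Fin r) (Fin s) R :=
  Matrix.of fun i j =>
    if (i : ℕ) = (j : ℕ) then y else if (i : ℕ) = (j : ℕ) + 1 then -x else 0

end Defs

section RegularSystem

variable {R : Type*} [CommRing R] [IsLocalRing R]

/-- A non-maximal prime containing one of the two generators of the maximal ideal is generated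
by it. -/
theorem prime_eq_span_singleton [IsNoetherianRing R] {x y : R}
    (hm : maximalIdeal R = Ideal.span {x, y}) {Q : Ideal R} (hQ : Q.IsPrime) (hx : x ∈ Q)
    (hne : Q ≠ maximalIdeal R) : Q = Ideal.span {x} := by
  refine le_antisymm ?_ ((Ideal.span_singleton_le_iff_mem _).2 hx)
  have hy : y ∉ Q := fun hy => hne <| le_antisymm (le_maximalIdeal hQ.ne_top) <| by
    rw [hm, Ideal.span_le]
    rintro z (rfl | rfl)
    exacts [hx, hy]
  refine Submodule.le_of_le_smul_of_le_jacobson_bot (I := maximalIdeal R)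
    (IsNoetherian.noetherian Q) (maximalIdeal_le_jacobson _) fun z hz => ?_
  have hz' : z ∈ Ideal.span {x, y} := hm ▸ le_maximalIdeal hQ.ne_top hz
  obtain ⟨α, β, rfl⟩ := Ideal.mem_span_pair.1 hz'
  have hβ : β * y ∈ Q := (Ideal.add_mem_iff_right _ (Q.mul_mem_left α hx)).1 hz
  refine Submodule.add_mem_sup (Ideal.mem_span_singleton'.2 ⟨α, rfl⟩) ?_
  rw [mul_comm]
  exact Submodule.smul_mem_smul (hm ▸ Ideal.subset_span (by simp))
    ((hQ.mem_or_mem hβ).resolve_right hy)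

/-- In a two-dimensional regular local ring with maximal ideal `(x, y)`, zero is a prime ideal and
`x` is a prime element not dividing `y`. -/
theorem IsTwoDimRegularLocal.isDomain_and_prime (hreg : IsTwoDimRegularLocal R) {x y : R}
    (hm : maximalIdeal R = Ideal.span {x, y}) :
    IsDomain R ∧ Prime x ∧ ¬ x ∣ y := by
  obtain ⟨_, hdim, -⟩ := hreg
  obtain ⟨l, hl⟩ := (Order.le_krullDim_iff (α := PrimeSpectrum R) (n := 2)).1 hdim.ge
  obtain ⟨P₀, P₁, P₂, h01, h12⟩ : ∃ P₀ P₁ P₂ : PrimeSpectrum R, P₀ < P₁ ∧ P₁ < P₂ :=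
    ⟨l ⟨0, by omega⟩, l ⟨1, by omega⟩, l ⟨2, by omega⟩, l.strictMono (by simp [Fin.lt_def]),
      l.strictMono (by simp [Fin.lt_def])⟩
  have h1m : P₁.asIdeal < maximalIdeal R :=
    lt_of_lt_of_le h12 (le_maximalIdeal P₂.isPrime.ne_top)
  have hxm : x ∈ maximalIdeal R := hm ▸ Ideal.subset_span (by simp)
  have hx0 : x ∉ P₀.asIdeal := fun hx => by
    have := prime_eq_span_singleton hm P₁.isPrime (h01.le hx) h1m.ne
    exact h01.not_ge (show P₁.asIdeal ≤ P₀.asIdeal by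
      rw [this, Ideal.span_singleton_le_iff_mem]; exact hx)
  obtain ⟨Q, hQ, hQm⟩ := Ideal.exists_minimalPrimes_le
    (show Ideal.span (insert x (P₀.asIdeal : Set R)) ≤ maximalIdeal R by
      rw [Ideal.span_le, Set.insert_subset_iff]
      exact ⟨hxm, le_trans (b := P₁.asIdeal) h01.le h1m.le⟩)
  have hQne : Q ≠ maximalIdeal R := by
    rintro rfl
    have hmin := Ideal.mem_minimalPrimes_span_of_mem_minimalPrimes_span_insert h1m x
      (P₀.asIdeal : Set R) hQ (P₀.asIdeal : Set R) h01.le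
      (fun z hz => Ideal.le_radical (Ideal.subset_span (Set.mem_insert_of_mem _ hz)))
    rw [Ideal.span_eq] at hmin
    exact h01.not_ge (hmin.2 ⟨P₀.isPrime, le_rfl⟩ h01.le)
  have hxQ : x ∈ Q := hQ.1.2 (Ideal.subset_span (Set.mem_insert _ _))
  have hQx := prime_eq_span_singleton hm hQ.1.1 hxQ hQne
  have hP₀ : P₀.asIdeal = ⊥ := by
    refine Submodule.eq_bot_of_le_smul_of_le_jacobson_bot (maximalIdeal R) _
      (IsNoetherian.noetherian _) (fun z hz => ?_) (maximalIdeal_le_jacobson _)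
    have hzQ : z ∈ Q := hQ.1.2 (Ideal.subset_span (Set.mem_insert_of_mem _ hz))
    rw [hQx] at hzQ
    obtain ⟨t, rfl⟩ := Ideal.mem_span_singleton.1 hzQ
    exact Submodule.smul_mem_smul hxm ((P₀.isPrime.mem_or_mem hz).resolve_left hx0)
  have hprime : (⊥ : Ideal R).IsPrime := hP₀ ▸ P₀.isPrime
  have hdom : IsDomain R := IsDomain.of_bot_isPrime R
  have hxne : x ≠ 0 := fun h => hx0 (h ▸ P₀.asIdeal.zero_mem)
  refine ⟨hdom, (Ideal.span_singleton_prime hxne).1 (hQx ▸ hQ.1.1), fun hxy => hQne ?_⟩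
  refine le_antisymm hQm ?_
  rw [hm, Ideal.span_le]
  rintro z (rfl | rfl)
  exacts [hxQ, Q.mem_of_dvd hxy hxQ]

end RegularSystem

section IntegralClosure

variable {R : Type*} [CommRing R]

theorem MemIntClosure.mono {I J : Ideal R} (h : I ≤ J) {z : R} (hz : MemIntClosure I z) :
    MemIntClosure J z := by
  obtain ⟨n, hn, c, hc, h0⟩ := hz
  exact ⟨n, hn, c, fun i hi => Ideal.pow_right_mono h i (hc i hi), h0⟩

/-- The determinant trick: if `d N ⊆ I N` for a nonzero finitely generated ideal `N` of a domain,
then `d` is integral over `I`. -/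
theorem memIntClosure_of_mul_mem [IsDomain R] {I N : Ideal R} (hfg : N.FG) (hN : N ≠ ⊥) {d : R}
    (h : ∀ z ∈ N, d * z ∈ I * N) : MemIntClosure I d := by
  have : Module.Finite R N := Module.Finite.iff_fg.2 hfg
  obtain ⟨p, hp, -, hcoeff, hp0⟩ :=
    LinearMap.exists_monic_and_natDegree_eq_and_coeff_mem_pow_and_aeval_eq_zero R
      (algebraMap R (Module.End R N) d) I (by
        rintro _ ⟨z, rfl⟩
        rw [Submodule.mem_smul_top_iff]
        exact h z z.2)
  obtain ⟨z, hz, hz0⟩ := Submodule.exists_mem_ne_zero_of_ne_bot hN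
  have heval : p.eval d = 0 := by
    rw [Polynomial.aeval_algebraMap_apply_eq_algebraMap_eval] at hp0
    have := congrArg Subtype.val (LinearMap.congr_fun hp0 (⟨z, hz⟩ : N))
    exact (mul_eq_zero.1 this).resolve_right hz0
  refine ⟨p.natDegree, Nat.pos_of_ne_zero fun h0 => ?_, fun i => p.coeff (p.natDegree - i),
    fun i hi => ?_, ?_⟩
  · rw [hp.natDegree_eq_zero.1 h0] at heval
    simp at heval
  · convert hcoeff (p.natDegree - i)
    have := (Finset.mem_Icc.1 hi).2
    omega
  · rw [Polynomial.eval_eq_sum_range, ← Finset.sum_flip, Finset.sum_range_succ', add_comm] at heval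
    rw [← heval, show Finset.Icc 1 p.natDegree = Finset.Ico 1 (p.natDegree + 1) from rfl,
      Finset.sum_Ico_eq_sum_range]
    simp [hp.coeff_natDegree, add_comm]

theorem det_mem_prod {n : Type*} [Fintype n] [DecidableEq n] (A : Matrix n n R) (J : n → Ideal R)
    (h : ∀ i j, A i j ∈ J i) : A.det ∈ ∏ i, J i := by
  rw [← Matrix.det_transpose, Matrix.det_apply]
  exact Ideal.sum_mem _ fun σ _ => Submodule.smul_of_tower_mem _ _ <|
    Ideal.prod_mem_prod fun i _ => h i (σ i)

end IntegralClosure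

section BinaryForms

variable {R : Type*} [CommRing R]

/-- The linear map `R^r → R` sending `c` to
`c 0 * x ^ (r - 1) + c 1 * x ^ (r - 2) * y + ⋯ + c (r - 1) * y ^ (r - 1)`. -/
def formMap (r : ℕ) (x y : R) : (Fin r → R) →ₗ[R] R :=
  Fintype.linearCombination R fun i : Fin r => x ^ (r - 1 - (i : ℕ)) * y ^ (i : ℕ)

theorem formMap_apply (r : ℕ) (x y : R) (c : Fin r → R) :
    formMap r x y c = ∑ i : Fin r, c i * x ^ (r - 1 - (i : ℕ)) * y ^ (i : ℕ) := by
  simp [formMap, Fintype.linearCombination_apply, mul_assoc]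

theorem formMap_succ (s : ℕ) (x y : R) (c : Fin (s + 2) → R) :
    formMap (s + 2) x y c = c 0 * x ^ (s + 1) + y * formMap (s + 1) x y (Fin.tail c) := by
  rw [formMap_apply, formMap_apply, Fin.sum_univ_succ, Finset.mul_sum]
  congr 1
  · simp
  · refine Finset.sum_congr rfl fun i _ => ?_
    have : s + 2 - 1 - ((i.succ : Fin (s + 2)) : ℕ) = s + 1 - 1 - (i : ℕ) := by
      simp only [Fin.val_succ]; omega
    rw [this, Fin.val_succ, Fin.tail]
    ring

theorem stdRelCol_succ (s : ℕ) (x y : R) (k : ℕ) :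
    stdRelCol (s + 2) x y (k + 1) = Fin.cons 0 (stdRelCol (s + 1) x y k) := by
  funext i
  refine Fin.cases ?_ (fun i => ?_) i <;> simp [stdRelCol]

theorem formMap_stdRelCol (s : ℕ) (x y : R) {k : ℕ} (hk : k < s) :
    formMap (s + 1) x y (stdRelCol (s + 1) x y k) = 0 := by
  induction s generalizing k with
  | zero => omega
  | succ s ih =>
    cases k with
    | zero =>
      rw [formMap_succ]
      have : Fin.tail (stdRelCol (s + 2) x y 0) = Pi.single 0 (-x) := by
        funext i
        refine Fin.cases ?_ (fun i => ?_) i <;> simp [stdRelCol, Fin.tail]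
      rw [this, formMap, Fintype.linearCombination_apply_single]
      simp [stdRelCol]
      ring
    | succ k =>
      rw [stdRelCol_succ, formMap_succ, Fin.tail_cons, ih (by omega)]
      simp

/-- The linear relations between `x ^ s, x ^ (s - 1) * y, …, y ^ s` are generated by the standard
ones. -/
theorem mem_span_stdRelCol [IsDomain R] {x y : R} (hy : Prime y) (hyx : ¬ y ∣ x) (s : ℕ)
    {v : Fin (s + 1) → R} (hv : formMap (s + 1) x y v = 0) :
    v ∈ Submodule.span R { v | ∃ k, k < s ∧ v = stdRelCol (s + 1) x y k } := by
  induction s with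
  | zero =>
    have : v = 0 := by
      funext i
      have hi : i = 0 := Subsingleton.elim (α := Fin 1) _ _
      simpa [formMap_apply, hi] using hv
    exact this ▸ Submodule.zero_mem _
  | succ s ih =>
    rw [formMap_succ] at hv
    obtain ⟨t, ht⟩ : y ∣ v 0 := by
      refine (hy.dvd_or_dvd (b := x ^ (s + 1)) ?_).resolve_right fun h => hyx (hy.dvd_of_dvd_pow h)
      exact ⟨-formMap (s + 1) x y (Fin.tail v), by linear_combination hv⟩
    set w := v - t • stdRelCol (s + 2) x y 0 with hw
    have hw0 : w 0 = 0 := by simp [hw, stdRelCol, ht, mul_comm]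
    have hform : formMap (s + 2) x y w = 0 := by
      rw [hw, map_sub, map_smul, formMap_stdRelCol _ _ _ (Nat.succ_pos s), formMap_succ, hv]
      simp
    rw [formMap_succ, hw0, zero_mul, zero_add] at hform
    have htail := ih ((mul_eq_zero.1 hform).resolve_left hy.ne_zero)
    let ι : (Fin (s + 1) → R) →ₗ[R] (Fin (s + 2) → R) :=
      { toFun := fun u => Fin.cons 0 u
        map_add' := fun u u' => by
          funext i; refine Fin.cases ?_ (fun i => ?_) i <;> simp
        map_smul' := fun c u => by
          funext i; refine Fin.cases ?_ (fun i => ?_) i <;> simp }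
    have hwmem : w ∈ Submodule.span R { v | ∃ k, k < s + 1 ∧ v = stdRelCol (s + 2) x y k } := by
      have h1 : w = ι (Fin.tail w) := by
        rw [← Fin.cons_self_tail w, hw0]; rfl
      rw [h1]
      refine (Submodule.map_span_le ι _ _).2 ?_ (Submodule.mem_map_of_mem htail)
      rintro _ ⟨k, hk, rfl⟩
      exact Submodule.subset_span ⟨k + 1, by omega, (stdRelCol_succ s x y k).symm⟩
    have hv' : v = w + t • stdRelCol (s + 2) x y 0 := by rw [hw, sub_add_cancel]
    rw [hv']
    exact Submodule.add_mem _ hwmem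
      (Submodule.smul_mem _ _ (Submodule.subset_span ⟨0, Nat.succ_pos s, rfl⟩))

theorem span_pair_pow_le (x y : R) (s : ℕ) :
    Ideal.span {x, y} ^ s ≤
      Ideal.span (Set.range fun i : Fin (s + 1) => x ^ (s - (i : ℕ)) * y ^ (i : ℕ)) := by
  induction s with
  | zero => simp [Ideal.span_singleton_one]
  | succ s ih =>
    rw [pow_succ]
    refine (Ideal.mul_mono_left ih).trans ?_
    rw [Ideal.span_mul_span', Ideal.span_le]
    rintro _ ⟨_, ⟨i, rfl⟩, z, hz, rfl⟩
    rcases hz with rfl | rfl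
    · refine Ideal.subset_span ⟨i.castSucc, ?_⟩
      have : s + 1 - (i : ℕ) = s - i + 1 := by omega
      simp only [Fin.val_castSucc, this]
      ring
    · refine Ideal.subset_span ⟨i.succ, ?_⟩
      simp only [Fin.val_succ, Nat.add_sub_add_right]
      ring

theorem exists_formMap_eq {x y : R} {J : Ideal R} {s : ℕ} {z : R}
    (hz : z ∈ J * Ideal.span {x, y} ^ s) :
    ∃ c : Fin (s + 1) → R, (∀ i, c i ∈ J) ∧ formMap (s + 1) x y c = z := by
  obtain ⟨c, hc, rfl⟩ := (Submodule.mem_ideal_smul_span_iff_exists_sum J _ _).1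
    (Ideal.mul_mono_right (span_pair_pow_le x y s) hz)
  refine ⟨c, hc, ?_⟩
  rw [formMap, Fintype.linearCombination_apply, Finsupp.sum_fintype _ _ (by simp)]
  rfl

theorem pow_mul_pow_mul_colDet (s : ℕ) (x y : R) (w : Fin (s + 1) → Fin (s + 1) → R)
    (i : Fin (s + 1)) :
    x ^ (s - (i : ℕ)) * y ^ (i : ℕ) * colDet w =
      ((Matrix.of fun i j => w j i).updateRow i fun j => formMap (s + 1) x y (w j)).det := by
  rw [colDet, ← smul_eq_mul, ← Matrix.det_updateRow_sum _ i
    fun k : Fin (s + 1) => x ^ (s - (k : ℕ)) * y ^ (k : ℕ)]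
  congr 2
  funext j
  simp [formMap_apply, Finset.sum_apply, mul_comm, mul_left_comm]

theorem colDet_cons_stdRelCol [IsDomain R] {x : R} (hx : x ≠ 0) (y : R) (s : ℕ)
    (v : Fin (s + 1) → R) :
    colDet (Fin.cons v fun k : Fin s => stdRelCol (s + 1) x y k) =
      (-1) ^ s * formMap (s + 1) x y v := by
  refine mul_left_cancel₀ (pow_ne_zero s hx) ?_
  have h := pow_mul_pow_mul_colDet s x y (Fin.cons v fun k : Fin s => stdRelCol (s + 1) x y k) 0
  simp only [Fin.val_zero, tsub_zero, pow_zero, mul_one] at h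
  rw [h, Matrix.det_succ_row_zero, Fin.sum_univ_succ, Finset.sum_eq_zero, add_zero]
  · rw [Matrix.det_of_isUpperTriangular]
    · simp [Matrix.updateRow_apply, stdRelCol, Fin.succAbove_zero]
      ring
    · intro i j hij
      have hij' : (j : ℕ) < i := hij
      have h1 : (i : ℕ) + 1 ≠ j := by omega
      have h2 : (i : ℕ) ≠ j := by omega
      simp [Matrix.updateRow_apply, stdRelCol, Fin.succAbove_zero, h1, h2]
  · intro k _
    simp [formMap_stdRelCol s x y k.2]

end BinaryForms

section Main

variable {R : Type*} [CommRing R]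

/-- If the columns of a square matrix have entries in `(x, y)` and their images under `formMap` lie
in `I`, then its determinant is integral over `I`. -/
theorem memIntClosure_colDet [IsDomain R] [IsNoetherianRing R] {x y : R} (hx : x ≠ 0) {s : ℕ}
    {I : Ideal R} (w : Fin (s + 1) → Fin (s + 1) → R)
    (hm : ∀ j i, w j i ∈ Ideal.span {x, y}) (hI : ∀ j, formMap (s + 1) x y (w j) ∈ I) :
    MemIntClosure I (colDet w) := by
  have hxs : x ^ s ∈ Ideal.span {x, y} ^ s := Ideal.pow_mem_pow (Ideal.subset_span (by simp)) s
  refine memIntClosure_of_mul_mem (N := Ideal.span {x, y} ^ s) (IsNoetherian.noetherian _)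
    (fun h => pow_ne_zero s hx (by simpa [h] using hxs)) fun z hz => ?_
  rw [← one_mul (Ideal.span {x, y} ^ s)] at hz
  obtain ⟨c, -, rfl⟩ := exists_formMap_eq hz
  rw [formMap_apply, Finset.mul_sum]
  refine Ideal.sum_mem _ fun i _ => ?_
  have key : x ^ (s - (i : ℕ)) * y ^ (i : ℕ) * colDet w ∈ I * Ideal.span {x, y} ^ s := by
    rw [pow_mul_pow_mul_colDet]
    convert det_mem_prod _ (Function.update (fun _ => Ideal.span {x, y}) i I) fun k j => ?_
    · rw [Finset.prod_update_of_mem (Finset.mem_univ i)]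
      simp [Finset.card_sdiff]
    · by_cases hk : k = i
      · subst hk; simpa using hI j
      · simpa [hk] using hm j k
  convert Ideal.mul_mem_left _ (c i) key using 1
  simp only [add_tsub_cancel_right]
  ring

/-- `M_r(I)` is the preimage of `I` under `formMap`. -/
theorem mem_MrSpan_iff [IsDomain R] {x y : R} (hy : Prime y) (hyx : ¬ y ∣ x) {s m : ℕ}
    {I : Ideal R} {a : Fin m → R} {C : Fin m → Fin (s + 1) → R}
    (ha : Ideal.span (Set.range a) = I) (hC : ∀ j, Expresses (s + 1) x y (C j) (a j))
    {v : Fin (s + 1) → R} :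
    v ∈ MrSpan (s + 1) x y C ↔ formMap (s + 1) x y v ∈ I := by
  have hC' : ∀ j, formMap (s + 1) x y (C j) = a j := fun j => by rw [formMap_apply, ← hC j]
  constructor
  · intro hv
    refine (Submodule.span_le (p := Submodule.comap (formMap (s + 1) x y) I)).2 ?_ hv
    rintro _ (⟨j, rfl⟩ | ⟨k, hk, rfl⟩)
    · rw [SetLike.mem_coe, Submodule.mem_comap, hC', ← ha]
      exact Ideal.subset_span ⟨j, rfl⟩
    · rw [SetLike.mem_coe, Submodule.mem_comap, formMap_stdRelCol s x y hk]
      exact I.zero_mem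
  · intro hv
    rw [← ha, Ideal.mem_span_range_iff_exists_fun] at hv
    obtain ⟨d, hd⟩ := hv
    have hker : formMap (s + 1) x y (v - ∑ j, d j • C j) = 0 := by
      rw [map_sub, map_sum, ← hd]
      simp [hC']
    rw [← sub_add_cancel v (∑ j, d j • C j)]
    refine Submodule.add_mem _ (Submodule.span_mono Set.subset_union_right
      (mem_span_stdRelCol hy hyx s hker)) (Submodule.sum_mem _ fun j _ => Submodule.smul_mem _ _ <|
        Submodule.subset_span (Or.inl ⟨j, rfl⟩))

/-- If `formMap v` lies in `(x, y) ^ (s + 1)`, then the entries of `v` lie in `(x, y)`. -/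
theorem apply_mem_span_pair [IsDomain R] {x y : R} (hy : Prime y) (hyx : ¬ y ∣ x) {s : ℕ}
    {v : Fin (s + 1) → R} (hv : formMap (s + 1) x y v ∈ Ideal.span {x, y} ^ (s + 1))
    (i : Fin (s + 1)) : v i ∈ Ideal.span {x, y} := by
  rw [pow_succ'] at hv
  obtain ⟨c, hc, hcv⟩ := exists_formMap_eq hv
  have hker : formMap (s + 1) x y (v - c) = 0 := by
    rw [LinearMap.map_sub, hcv, sub_self]
  have hle : Submodule.span R { v | ∃ k, k < s ∧ v = stdRelCol (s + 1) x y k } ≤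
      Submodule.comap (LinearMap.proj i : (Fin (s + 1) → R) →ₗ[R] R) (Ideal.span {x, y}) := by
    rw [Submodule.span_le]
    rintro _ ⟨k, -, rfl⟩
    change stdRelCol (s + 1) x y k i ∈ Ideal.span {x, y}
    have hx : x ∈ Ideal.span {x, y} := Ideal.subset_span (by simp)
    have hy : y ∈ Ideal.span {x, y} := Ideal.subset_span (by simp)
    unfold stdRelCol
    split_ifs
    exacts [hy, neg_mem hx, zero_mem _]
  have := Ideal.add_mem _ (hle (mem_span_stdRelCol hy hyx s hker)) (hc i)
  simpa using this

end Main

/-- for an integrally closed `𝔪`-primary ideal `I` with `ord(I) = n ≥ r ≥ 2`,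
the module `M = M_r(I)` is integrally closed. -/
theorem statement4 (R : Type*) [CommRing R] [IsLocalRing R]
    (hreg : IsTwoDimRegularLocal R) [Infinite (IsLocalRing.ResidueField R)]
    (I : Ideal R) (hIc : IdealIntClosed I) (hIp : IsMPrimary I)
    (r n : ℕ) (hr : 2 ≤ r) (hrn : r ≤ n) (hord : ordEQ I n)
    (m : ℕ) (x y : R) (a : Fin (m + 1) → R) (C : Fin (m + 1) → Fin r → R)
    (hpres : IsMrPresentation r I x y a C) :
    ModIntClosed (MrSpan r x y C) := by
  obtain ⟨s, rfl⟩ : ∃ s, r = s + 1 := ⟨r - 1, by omega⟩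
  obtain ⟨hm, ⟨ha, -⟩, hC⟩ := hpres
  obtain ⟨hdom, hx, -⟩ := hreg.isDomain_and_prime hm
  obtain ⟨-, hy, hyx⟩ := hreg.isDomain_and_prime (x := y) (y := x) (by rw [hm, Set.pair_comm])
  have hnoeth : IsNoetherianRing R := hreg.1
  have hMI {v : Fin (s + 1) → R} := mem_MrSpan_iff hy hyx ha hC (v := v)
  have hIs : I ≤ Ideal.span {x, y} ^ (s + 1) := hm ▸ hord.1.trans (Ideal.pow_le_pow_right hrn)
  have hminors : maxMinors (MrSpan (s + 1) x y C) ≤ I := by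
    refine Ideal.span_le.2 ?_
    rintro _ ⟨w, hw, rfl⟩
    have hw' j := hMI.1 (hw j)
    exact hIc _ <| memIntClosure_colDet hx.ne_zero w
      (fun j => apply_mem_span_pair hy hyx (hIs (hw' j))) hw'
  intro v hv
  have hdet := hIc _ <| (hv (Fin.cons v fun k : Fin s => stdRelCol (s + 1) x y k) 0 rfl
    fun j hj => by
      obtain ⟨k, rfl⟩ := Fin.exists_succ_eq.2 hj
      exact Submodule.subset_span (Or.inr ⟨k, k.2, by simp⟩)).mono hminors
  rw [colDet_cons_stdRelCol hx.ne_zero] at hdet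
  exact hMI.2 ((Ideal.unit_mul_mem_iff_mem _ ((isUnit_neg_one).pow s)).1 hdet)
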